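/- There is an absolute constant C > 0 such that for every f ∈ C_c^∞(ℝ²) and every t ≥ 0, ‖f‖_{L^∞(ℝ²)} ≤ C ⟨t⟩^{−1/2} ( ‖f‖_{L²(ℝ²)} + ‖⟨|x| − t⟩ ∇ Γ̃^{≤1} f‖_{L²(ℝ²)} ), where Γ̃ = (∂_1, ∂_2, ∂_θ) with ∂_θ = x_1∂_2 − x_2∂_1, and Γ̃^{≤1} f denotes the collection f, ∂_1 f, ∂_2 f, ∂_θ f. -/

import Mathlib

open MeasureTheory Real

noncomputable section

/-- Spacetime ℝ_t × ℝ²_x; coordinate 0 is time, coordinates 1, 2 are space. -/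
abbrev Spt := Fin 3 → ℝ
/-- Space ℝ². -/
abbrev Sp := Fin 2 → ℝ

/-- Partial derivative ∂_i on spacetime (∂_0 = ∂_t). -/
def pd (i : Fin 3) (u : Spt → ℝ) : Spt → ℝ :=
  fun y => fderiv ℝ u y (Pi.single i 1)

/-- Spatial partial derivative ∂_i on ℝ² (index 0 ↔ x₁, index 1 ↔ x₂). -/
def spd (i : Fin 2) (f : Sp → ℝ) : Sp → ℝ :=
  fun x => fderiv ℝ f x (Pi.single i 1)

/-- The wave operator □ = ∂_tt − Δ. -/
def Box (u : Spt → ℝ) : Spt → ℝ :=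
  fun y => pd 0 (pd 0 u) y - pd 1 (pd 1 u) y - pd 2 (pd 2 u) y

/-- r = |x|, the spatial Euclidean norm of a spacetime point. -/
def rad (y : Spt) : ℝ := Real.sqrt ((y 1) ^ 2 + (y 2) ^ 2)

/-- The Euclidean norm on ℝ². -/
def nrm2 (x : Sp) : ℝ := Real.sqrt ((x 0) ^ 2 + (x 1) ^ 2)

/-- ω₀ = −1, ω_i = x_i / |x| for i = 1, 2. -/
def om (i : Fin 3) (y : Spt) : ℝ := if i = 0 then -1 else y i / rad y

/-- The good derivatives T_i = ω_i ∂_t + ∂_i (note T_0 = 0). -/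
def Td (i : Fin 3) (u : Spt → ℝ) : Spt → ℝ :=
  fun y => om i y * pd 0 u y + pd i u y

/-- The vector fields Γ = (∂_t, ∂_1, ∂_2, ∂_θ, L₀) (no Lorentz boosts). -/
def Gam : Fin 5 → (Spt → ℝ) → Spt → ℝ :=
  ![pd 0, pd 1, pd 2,
    fun u y => y 1 * pd 2 u y - y 2 * pd 1 u y,
    fun u y => y 0 * pd 0 u y + y 1 * pd 1 u y + y 2 * pd 2 u y]

/-- Γ^α = Γ₁^{α₁} ∘ Γ₂^{α₂} ∘ Γ₃^{α₃} ∘ Γ₄^{α₄} ∘ Γ₅^{α₅}. -/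
def GamPow (α : Fin 5 → ℕ) (u : Spt → ℝ) : Spt → ℝ :=
  (Gam 0)^[α 0] <| (Gam 1)^[α 1] <| (Gam 2)^[α 2] <| (Gam 3)^[α 3] <| (Gam 4)^[α 4] u

/-- The multi-indices α with |α| ≤ k. -/
def midx (k : ℕ) : Finset (Fin 5 → ℕ) :=
  (Fintype.piFinset fun _ => Finset.range (k + 1)).filter fun α => (∑ i, α i) ≤ k

/-- The Japanese bracket ⟨s⟩ = (1 + s²)^{1/2}. -/
def jb (s : ℝ) : ℝ := Real.sqrt (1 + s ^ 2)

/-- The spacetime point (t, x). -/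
def st (t : ℝ) (x : Sp) : Spt := ![t, x 0, x 1]

/-- The null vector (−1, cos θ, sin θ). -/
def nullVec (θ : ℝ) : Fin 3 → ℝ := ![(-1 : ℝ), Real.cos θ, Real.sin θ]

/-- The standard null condition: g^{kij} ω_k ω_i ω_j = 0 for all null ω. -/
def NullCond (g : Fin 3 → Fin 3 → Fin 3 → ℝ) : Prop :=
  ∀ θ : ℝ, ∑ k, ∑ i, ∑ j, g k i j * nullVec θ k * nullVec θ i * nullVec θ j = 0

/-- The quadratic nonlinearity g^{kij} ∂_k u ∂_{ij} u. -/
def Quad (g : Fin 3 → Fin 3 → Fin 3 → ℝ) (u : Spt → ℝ) : Spt → ℝ :=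
  fun y => ∑ k, ∑ i, ∑ j, g k i j * pd k u y * pd i (pd j u) y

/-- The energy E_J(u(t,·)) = Σ_{|α|≤J} ‖(∂Γ^α u)(t,·)‖²_{L²(ℝ²)}. -/
def energy (J : ℕ) (u : Spt → ℝ) (t : ℝ) : ℝ :=
  ∑ α ∈ midx J, ∑ i : Fin 3, ∫ x : Sp, (pd i (GamPow α u) (st t x)) ^ 2

/-- The L² norm on ℝ². -/
def L2 (f : Sp → ℝ) : ℝ := Real.sqrt (∫ x : Sp, (f x) ^ 2)

/-- The angular derivative ∂_θ = x₁∂₂ − x₂∂₁ on ℝ². -/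
def dth (f : Sp → ℝ) : Sp → ℝ :=
  fun x => x 0 * spd 1 f x - x 1 * spd 0 f x

open Set

lemma ContDiff.spd {f : Sp → ℝ} (hf : ContDiff ℝ (⊤ : ℕ∞) f) (i : Fin 2) :
    ContDiff ℝ (⊤ : ℕ∞) (spd i f) := by
  unfold _root_.spd
  exact (hf.fderiv_right (m := (⊤ : ℕ∞)) le_rfl).clm_apply contDiff_const

lemma HasCompactSupport.spd {f : Sp → ℝ} (hf : HasCompactSupport f) (i : Fin 2) :
    HasCompactSupport (spd i f) :=
  hf.fderiv_apply ℝ _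

lemma ContDiff.dth {f : Sp → ℝ} (hf : ContDiff ℝ (⊤ : ℕ∞) f) :
    ContDiff ℝ (⊤ : ℕ∞) (dth f) := by
  have h0 := hf.spd 0
  have h1 := hf.spd 1
  unfold _root_.dth
  fun_prop

lemma HasCompactSupport.dth {f : Sp → ℝ} (hf : HasCompactSupport f) :
    HasCompactSupport (dth f) :=
  ((hf.spd 1).mul_left).sub ((hf.spd 0).mul_left)

lemma ContDiff.differentiable_top {f : Sp → ℝ} (hf : ContDiff ℝ (⊤ : ℕ∞) f) :
    Differentiable ℝ f :=
  hf.differentiable (by simp)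

lemma spd_mul {f g : Sp → ℝ} (hf : Differentiable ℝ f) (hg : Differentiable ℝ g) (i : Fin 2)
    (x : Sp) : spd i (fun y => f y * g y) x = spd i f x * g x + f x * spd i g x := by
  simp only [spd]
  rw [fderiv_fun_mul (hf x) (hg x)]
  simp
  ring

lemma spd_add {f g : Sp → ℝ} (hf : Differentiable ℝ f) (hg : Differentiable ℝ g) (i : Fin 2)
    (x : Sp) : spd i (fun y => f y + g y) x = spd i f x + spd i g x := by
  simp only [spd]
  rw [fderiv_fun_add (hf x) (hg x)]
  simp

lemma spd_coord (i j : Fin 2) (x : Sp) :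
    spd i (fun y => y j) x = if i = j then 1 else 0 := by
  simp only [spd]
  rw [show (fun y : Sp => y j) = ContinuousLinearMap.proj (R := ℝ) (φ := fun _ : Fin 2 => ℝ) j
    from rfl, ContinuousLinearMap.fderiv]
  simp [Pi.single_apply, eq_comm]

/-- The function `(|x|² - t²) / (|x|² + t²)`, which vanishes on the circle `|x| = t`. -/
def coneWeight (t : ℝ) (x : Sp) : ℝ :=
  (x 0 * x 0 + x 1 * x 1 - t ^ 2) / (x 0 * x 0 + x 1 * x 1 + t ^ 2)

/-- The function `1 / (|x|² + t²)`. -/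
def invWeight (t : ℝ) (x : Sp) : ℝ := (x 0 * x 0 + x 1 * x 1 + t ^ 2)⁻¹

section weight

variable {t : ℝ} (ht : 0 < t)
include ht

lemma normSq_add_sq_pos (x : Sp) : 0 < x 0 * x 0 + x 1 * x 1 + t ^ 2 := by
  nlinarith [mul_self_nonneg (x 0), mul_self_nonneg (x 1), pow_pos ht 2]

lemma contDiff_invWeight : ContDiff ℝ (⊤ : ℕ∞) (invWeight t) := by
  have h (x : Sp) : x 0 * x 0 + x 1 * x 1 + t ^ 2 ≠ 0 := (normSq_add_sq_pos ht x).ne'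
  unfold invWeight
  fun_prop (disch := exact h)

lemma coneWeight_eq : coneWeight t = fun x => 1 + (-2 * t ^ 2) * invWeight t x := by
  funext x
  have h : x 0 * x 0 + x 1 * x 1 + t ^ 2 ≠ 0 := (normSq_add_sq_pos ht x).ne'
  simp only [coneWeight, invWeight]
  field_simp
  ring

lemma contDiff_coneWeight : ContDiff ℝ (⊤ : ℕ∞) (coneWeight t) := by
  have := contDiff_invWeight ht
  rw [coneWeight_eq ht]
  fun_prop

lemma spd_invWeight (i : Fin 2) (x : Sp) :
    spd i (invWeight t) x = -2 * x i * invWeight t x ^ 2 := by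
  have h (x : Sp) : x 0 * x 0 + x 1 * x 1 + t ^ 2 ≠ 0 := (normSq_add_sq_pos ht x).ne'
  have hd : Differentiable ℝ fun x : Sp => x 0 * x 0 + x 1 * x 1 + t ^ 2 := by fun_prop
  have key : spd i (fun y => (y 0 * y 0 + y 1 * y 1 + t ^ 2) * invWeight t y) x = 0 := by
    have : (fun y : Sp => (y 0 * y 0 + y 1 * y 1 + t ^ 2) * invWeight t y) = fun _ => 1 := by
      funext y
      exact mul_inv_cancel₀ (h y)
    rw [this]
    simp [spd]
  rw [spd_mul hd (contDiff_invWeight ht).differentiable_top,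
    spd_add (by fun_prop) (by fun_prop), spd_add (by fun_prop) (by fun_prop),
    spd_mul (by fun_prop) (by fun_prop), spd_mul (by fun_prop) (by fun_prop),
    spd_coord, spd_coord, show spd i (fun _ => t ^ 2) x = 0 by simp [spd]] at key
  have hx := h x
  have e : invWeight t x = (x 0 * x 0 + x 1 * x 1 + t ^ 2)⁻¹ := rfl
  rw [← mul_right_inj' hx]
  have e' : (x 0 * x 0 + x 1 * x 1 + t ^ 2) * invWeight t x = 1 := by
    rw [e]; exact mul_inv_cancel₀ hx
  fin_cases i <;> simp at key ⊢
  · linear_combination key + 2 * x 0 * invWeight t x * e'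
  · linear_combination key + 2 * x 1 * invWeight t x * e'

lemma spd_coneWeight (i : Fin 2) :
    spd i (coneWeight t) = fun x => 4 * t ^ 2 * (x i * (invWeight t x * invWeight t x)) := by
  funext x
  rw [coneWeight_eq ht, spd_add (by fun_prop)
      (((contDiff_invWeight ht).differentiable_top).const_mul _),
    spd_mul (by fun_prop) (contDiff_invWeight ht).differentiable_top, spd_invWeight ht]
  simp [spd]
  ring

lemma spd_spd_coneWeight (x : Sp) :
    spd 0 (spd 1 (coneWeight t)) x = -16 * t ^ 2 * x 0 * x 1 * invWeight t x ^ 3 := by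
  have hi := (contDiff_invWeight ht).differentiable_top
  rw [spd_coneWeight ht, spd_mul (f := fun _ => 4 * t ^ 2) (by fun_prop) (by fun_prop),
    spd_mul (f := fun x => x 1) (by fun_prop) (by fun_prop),
    spd_mul hi hi, spd_invWeight ht, spd_coord]
  simp [spd]
  ring

end weight

lemma integral_spd_eq_zero {u : Sp → ℝ} (hu : ContDiff ℝ (⊤ : ℕ∞) u) (hc : HasCompactSupport u)
    (i : Fin 2) : ∫ x, spd i u x = 0 := by
  have h1 : Integrable (spd i u) := (hu.spd i).continuous.integrable_of_hasCompactSupport (hc.spd i)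
  have h2 : Integrable u := hu.continuous.integrable_of_hasCompactSupport hc
  have := integral_mul_fderiv_eq_neg_fderiv_mul_of_integrable (μ := (volume : Measure Sp))
    (f := u) (g := fun _ => (1 : ℝ)) (v := Pi.single i 1) (by simpa using! h1) (by simp)
    (by simpa using h2) (fun x _ => hu.differentiable_top x) (fun x _ => by fun_prop)
  simp at this
  exact this

lemma lintegral_sp_eq {G : Sp → ENNReal} :
    ∫⁻ x : Sp, G x = ∫⁻ p : ℝ × ℝ, G ![p.1, p.2] := by
  have := (volume_preserving_finTwoArrow ℝ).symm.lintegral_comp_emb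
    (MeasurableEquiv.measurableEmbedding _) G
  rw [← this]
  rfl

lemma enorm_le_lintegral_ray {u : Sp → ℝ} (hu : ContDiff ℝ (⊤ : ℕ∞) u) (hc : HasCompactSupport u)
    (a : Sp) {v : Sp} (hv : v ≠ 0) (b : ℝ) :
    ‖u (a + b • v)‖ₑ ≤ ∫⁻ s in Ioi b, ‖fderiv ℝ u (a + s • v) v‖ₑ := by
  have hd (s : ℝ) : HasDerivAt (fun s : ℝ => u (a + s • v)) (fderiv ℝ u (a + s • v) v) s := by
    have h1 : HasDerivAt (fun s : ℝ => a + s • v) v s := by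
      simpa using ((hasDerivAt_id s).smul_const v).const_add a
    exact (hu.differentiable_top _).hasFDerivAt.comp_hasDerivAt s h1
  have hcc : HasCompactSupport (fun s : ℝ => u (a + s • v)) := by
    refine hc.comp_isClosedEmbedding (g := fun s : ℝ => a + s • v) ?_
    exact (Homeomorph.addLeft a).isClosedEmbedding.comp (isClosedEmbedding_smul_left hv)
  have hcd : ContDiff ℝ 1 (fun s : ℝ => u (a + s • v)) :=
    (hu.of_le (by exact_mod_cast le_top)).comp (by fun_prop)
  have := hcc.integral_Ioi_deriv_eq hcd b
  rw [← enorm_neg, ← this]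
  refine (enorm_integral_le_lintegral_enorm _).trans_eq ?_
  simp_rw [fun s => (hd s).deriv]

lemma enorm_le_lintegral_spd_spd {u : Sp → ℝ} (hu : ContDiff ℝ (⊤ : ℕ∞) u)
    (hc : HasCompactSupport u) (x : Sp) : ‖u x‖ₑ ≤ ∫⁻ y : Sp, ‖spd 0 (spd 1 u) y‖ₑ := by
  have hm : Measurable fun p : ℝ × ℝ => ‖spd 0 (spd 1 u) ![p.1, p.2]‖ₑ := by
    have := ((hu.spd 1).spd 0).continuous
    exact (this.comp (by fun_prop)).measurable.enorm
  rw [lintegral_sp_eq, Measure.volume_eq_prod, lintegral_prod_symm _ hm.aemeasurable]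
  have h1 := enorm_le_lintegral_ray hu hc ![x 0, 0] (v := Pi.single 1 1) (by simp) (x 1)
  have e1 (s : ℝ) : ![x 0, 0] + s • (Pi.single 1 1 : Sp) = ![x 0, s] := by
    ext i; fin_cases i <;> simp
  have e0 (s r : ℝ) : ![0, s] + r • (Pi.single 0 1 : Sp) = ![r, s] := by
    ext i; fin_cases i <;> simp
  simp_rw [e1] at h1
  rw [show x = ![x 0, x 1] by ext i; fin_cases i <;> simp]
  refine h1.trans ((setLIntegral_le_lintegral _ _).trans (lintegral_mono fun s => ?_))
  have h0 := enorm_le_lintegral_ray (hu.spd 1) (hc.spd 1) ![0, s]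
    (v := Pi.single 0 1) (by simp) (x 0)
  simp_rw [e0] at h0
  exact h0.trans (setLIntegral_le_lintegral _ _)

/-- The point of the plane with polar coordinates `(r, θ)`. -/
def polarPt (r θ : ℝ) : Sp := ![r * cos θ, r * sin θ]

lemma polarPt_eq (r θ : ℝ) : polarPt r θ = 0 + r • polarPt 1 θ := by
  ext i; fin_cases i <;> simp [polarPt]

lemma exists_polarPt_eq (x : Sp) : ∃ θ ∈ Icc (-π) π, polarPt (nrm2 x) θ = x := by
  refine ⟨Complex.arg ⟨x 0, x 1⟩, ⟨(Complex.neg_pi_lt_arg _).le, Complex.arg_le_pi _⟩, ?_⟩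
  have h : nrm2 x = ‖(⟨x 0, x 1⟩ : ℂ)‖ := by
    rw [Complex.norm_eq_sqrt_sq_add_sq]; rfl
  ext i; fin_cases i <;> simp [polarPt, h, Complex.norm_mul_cos_arg, Complex.norm_mul_sin_arg]

lemma fderiv_apply_eq_spd (u : Sp → ℝ) (x v : Sp) :
    fderiv ℝ u x v = v 0 * spd 0 u x + v 1 * spd 1 u x := by
  have : v = v 0 • (Pi.single 0 1 : Sp) + v 1 • (Pi.single 1 1 : Sp) := by
    ext i; fin_cases i <;> simp
  conv_lhs => rw [this]
  simp [spd]

lemma lintegral_circle_le {u : Sp → ℝ} (hu : ContDiff ℝ (⊤ : ℕ∞) u)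
    (hc : HasCompactSupport u) {R : ℝ} (hR : 0 < R) :
    ENNReal.ofReal R * ∫⁻ θ in Ioc (-π) π, ‖u (polarPt R θ)‖ₑ ≤
      ∫⁻ x : Sp, (‖spd 0 u x‖ₑ + ‖spd 1 u x‖ₑ) := by
  have hm : Measurable fun x : Sp => ‖spd 0 u x‖ₑ + ‖spd 1 u x‖ₑ :=
    (hu.spd 0).continuous.measurable.enorm.add (hu.spd 1).continuous.measurable.enorm
  have hP : Measurable fun p : ℝ × ℝ => polarPt p.1 p.2 := by
    unfold polarPt
    exact Continuous.measurable (by fun_prop)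
  rw [lintegral_sp_eq, ← lintegral_comp_polarCoord_symm, polarCoord_target,
    Measure.volume_eq_prod, ← Measure.prod_restrict, lintegral_prod_symm]
  swap
  · exact ((ENNReal.measurable_ofReal.comp measurable_fst).mul (hm.comp hP)).aemeasurable
  rw [← restrict_Ioo_eq_restrict_Ioc, ← lintegral_const_mul' _ _ ENNReal.ofReal_ne_top]
  refine lintegral_mono fun θ => ?_
  have hv : polarPt 1 θ ≠ 0 := by
    intro h
    have h0 : cos θ = 0 := by simpa [polarPt] using congrFun h 0
    have h1 : sin θ = 0 := by simpa [polarPt] using congrFun h 1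
    simpa [h0, h1] using sin_sq_add_cos_sq θ
  have h := enorm_le_lintegral_ray hu hc 0 hv R
  simp_rw [← polarPt_eq] at h
  calc _ ≤ ENNReal.ofReal R * ∫⁻ s in Ioi R, ‖fderiv ℝ u (polarPt s θ) (polarPt 1 θ)‖ₑ := by
        gcongr
    _ = ∫⁻ s in Ioi R, ENNReal.ofReal R * ‖fderiv ℝ u (polarPt s θ) (polarPt 1 θ)‖ₑ :=
        (lintegral_const_mul' _ _ ENNReal.ofReal_ne_top).symm
    _ ≤ ∫⁻ s in Ioi R, ENNReal.ofReal s *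
          (‖spd 0 u (polarPt s θ)‖ₑ + ‖spd 1 u (polarPt s θ)‖ₑ) := by
        refine setLIntegral_mono' measurableSet_Ioi fun s hs => ?_
        gcongr
        · exact (mem_Ioi.1 hs).le
        · rw [fderiv_apply_eq_spd]
          refine (enorm_add_le _ _).trans ?_
          rw [enorm_mul, enorm_mul]
          have hcos : ‖polarPt 1 θ 0‖ₑ ≤ 1 := by
            rw [← ofReal_norm, ← ENNReal.ofReal_one]
            exact ENNReal.ofReal_le_ofReal (by simpa [polarPt] using abs_cos_le_one θ)
          have hsin : ‖polarPt 1 θ 1‖ₑ ≤ 1 := by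
            rw [← ofReal_norm, ← ENNReal.ofReal_one]
            exact ENNReal.ofReal_le_ofReal (by simpa [polarPt] using abs_sin_le_one θ)
          exact add_le_add (mul_le_of_le_one_left' hcos) (mul_le_of_le_one_left' hsin)
    _ ≤ _ := lintegral_mono_set (Ioi_subset_Ioi hR.le)

lemma enorm_le_lintegral_angle {h h' : ℝ → ℝ} (hd : ∀ θ, HasDerivAt h (h' θ) θ)
    (hc : Continuous h') {θ₀ : ℝ} (hθ : θ₀ ∈ Icc (-π) π) :
    ‖h θ₀‖ₑ ≤ (∫⁻ θ in Ioc (-π) π, ‖h θ‖ₑ) + ∫⁻ θ in Ioc (-π) π, ‖h' θ‖ₑ := by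
  have hy (y : ℝ) (hy : y ∈ Ioc (-π) π) :
      ‖h θ₀‖ₑ ≤ ‖h y‖ₑ + ∫⁻ θ in Ioc (-π) π, ‖h' θ‖ₑ := by
    have e : h θ₀ = h y + ∫ θ in y..θ₀, h' θ := by
      rw [intervalIntegral.integral_eq_sub_of_hasDerivAt (fun x _ => hd x)
        (hc.intervalIntegrable _ _)]
      ring
    rw [e]
    refine (enorm_add_le _ _).trans (add_le_add le_rfl ?_)
    have : ‖∫ θ in y..θ₀, h' θ‖ₑ = ‖∫ θ in uIoc y θ₀, h' θ‖ₑ := by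
      rw [← ofReal_norm, ← ofReal_norm, intervalIntegral.norm_integral_eq_norm_integral_uIoc]
    rw [this]
    refine (enorm_integral_le_lintegral_enorm _).trans (lintegral_mono_set ?_)
    exact Ioc_subset_Ioc (le_min hy.1.le hθ.1) (max_le hy.2 hθ.2)
  have hv : volume (Ioc (-π) π) = ENNReal.ofReal (2 * π) := by
    rw [Real.volume_Ioc]; ring_nf
  have h1 : (1 : ENNReal) ≤ ENNReal.ofReal (2 * π) := by
    rw [← ENNReal.ofReal_one]
    exact ENNReal.ofReal_le_ofReal (by linarith [pi_gt_three])
  have hi := setLIntegral_mono' (μ := volume) measurableSet_Ioc hy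
  rw [setLIntegral_const, lintegral_add_right _ measurable_const, setLIntegral_const, hv] at hi
  rw [← ENNReal.mul_le_mul_iff_left (c := ENNReal.ofReal (2 * π)) (by positivity)
    ENNReal.ofReal_ne_top, add_mul]
  exact hi.trans (add_le_add (le_mul_of_one_le_right' h1) le_rfl)

/-- The square of the integrand controlling `f`: `f² + ⟨|x| - t⟩² |∇ Γ̃^{≤1} f|²`. -/
def energyDensity (t : ℝ) (f : Sp → ℝ) (x : Sp) : ℝ :=
  f x ^ 2 + (jb (nrm2 x - t)) ^ 2 *
    ∑ a : Fin 2, ((spd a f x) ^ 2 + (spd a (spd 0 f) x) ^ 2 +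
      (spd a (spd 1 f) x) ^ 2 + (spd a (dth f) x) ^ 2)

lemma jb_sq (s : ℝ) : jb s ^ 2 = 1 + s ^ 2 := Real.sq_sqrt (by positivity)

lemma nrm2_sq (x : Sp) : nrm2 x ^ 2 = x 0 * x 0 + x 1 * x 1 := by
  rw [nrm2, Real.sq_sqrt (by positivity)]; ring

lemma nrm2_nonneg (x : Sp) : 0 ≤ nrm2 x := Real.sqrt_nonneg _

lemma energyDensity_nonneg (t : ℝ) (f : Sp → ℝ) (x : Sp) : 0 ≤ energyDensity t f x := by
  unfold energyDensity; positivity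

/-- The pointwise inequality behind the Hardy estimate, with the multiplier
`x (|x|² - t²) / (|x|² + t²)`. -/
lemma cone_hardy_bound {r t G A B D : ℝ} (hr0 : 0 ≤ r) (ht : 0 < t) (hA0 : 0 ≤ A) (hB0 : 0 ≤ B)
    (hgr : G ^ 2 ≤ r ^ 2 * A) (hcs : D ^ 2 ≤ r ^ 2 * B) :
    1 / 4 * G ^ 2 ≤ (2 * ((r ^ 2 - t ^ 2) / (r ^ 2 + t ^ 2)) +
        4 * t ^ 2 * r ^ 2 * ((r ^ 2 + t ^ 2)⁻¹) ^ 2) * G ^ 2 +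
      2 * ((r ^ 2 - t ^ 2) / (r ^ 2 + t ^ 2)) * G * D + 40 * ((r - t) ^ 2 * (A + B)) := by
  have hP' : 0 < r ^ 2 + t ^ 2 := by positivity
  set q := (r ^ 2 - t ^ 2) / (r ^ 2 + t ^ 2) with hqd
  have hqr : (q * r) ^ 2 ≤ 4 * (r - t) ^ 2 := by
    rw [hqd, div_mul_eq_mul_div, div_pow, div_le_iff₀ (by positivity)]
    have h1 : (r + t) * r ≤ 2 * (r ^ 2 + t ^ 2) := by nlinarith [sq_nonneg (r - t)]
    have h2 : ((r + t) * r) ^ 2 ≤ (2 * (r ^ 2 + t ^ 2)) ^ 2 :=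
      pow_le_pow_left₀ (by positivity) h1 2
    nlinarith [mul_le_mul_of_nonneg_left h2 (sq_nonneg (r - t))]
  have hqD : (q * D) ^ 2 ≤ 4 * (r - t) ^ 2 * B := by
    calc (q * D) ^ 2 = q ^ 2 * D ^ 2 := by ring
      _ ≤ q ^ 2 * (r ^ 2 * B) := by gcongr
      _ = (q * r) ^ 2 * B := by ring
      _ ≤ _ := by gcongr
  have hcross : -(1 / 4 * G ^ 2) - 16 * ((r - t) ^ 2 * B) ≤ 2 * q * G * D := by
    nlinarith [sq_nonneg (G / 2 + 2 * (q * D))]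
  have hmain : 1 / 2 * G ^ 2 ≤
      (2 * q + 4 * t ^ 2 * r ^ 2 * ((r ^ 2 + t ^ 2)⁻¹) ^ 2) * G ^ 2 +
        40 * ((r - t) ^ 2 * A) := by
    have hdr : 2 * q + 4 * t ^ 2 * r ^ 2 * ((r ^ 2 + t ^ 2)⁻¹) ^ 2 =
        (2 * (r ^ 4 - t ^ 4) + 4 * t ^ 2 * r ^ 2) / (r ^ 2 + t ^ 2) ^ 2 := by
      rw [hqd]; field_simp; ring
    rw [hdr]
    have hrA : 0 ≤ (r - t) ^ 2 * A := by positivity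
    rcases le_or_gt (4 / 5 * t) r with h | h
    · have : 1 / 2 ≤ (2 * (r ^ 4 - t ^ 4) + 4 * t ^ 2 * r ^ 2) / (r ^ 2 + t ^ 2) ^ 2 := by
        rw [le_div_iff₀ (by positivity)]
        have h2 : (4 / 5 * t) ^ 2 ≤ r ^ 2 := pow_le_pow_left₀ (by positivity) h 2
        have h4 : ((4 / 5 * t) ^ 2) ^ 2 ≤ (r ^ 2) ^ 2 := pow_le_pow_left₀ (by positivity) h2 2
        nlinarith [mul_le_mul_of_nonneg_left h2 (sq_nonneg t)]
      have := mul_le_mul_of_nonneg_right this (sq_nonneg G)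
      linarith
    · have : -2 ≤ (2 * (r ^ 4 - t ^ 4) + 4 * t ^ 2 * r ^ 2) / (r ^ 2 + t ^ 2) ^ 2 := by
        rw [le_div_iff₀ (by positivity)]
        nlinarith [sq_nonneg (r * t), sq_nonneg (r ^ 2)]
      have := mul_le_mul_of_nonneg_right this (sq_nonneg G)
      have h2 : r ^ 2 ≤ (4 * (t - r)) ^ 2 := pow_le_pow_left₀ hr0 (by linarith) 2
      have := mul_le_mul_of_nonneg_right h2 hA0
      linarith
  nlinarith [mul_nonneg (sq_nonneg (r - t)) hA0, mul_nonneg (sq_nonneg (r - t)) hB0]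

lemma HasCompactSupport.sq {f : Sp → ℝ} (hc : HasCompactSupport f) :
    HasCompactSupport fun x => f x ^ 2 := by
  simp_rw [pow_two]
  exact hc.mul_left

section smooth

variable {f : Sp → ℝ} (hf : ContDiff ℝ (⊤ : ℕ∞) f) (hc : HasCompactSupport f)
include hf hc

lemma integrable_sq : Integrable fun x => f x ^ 2 := by
  refine (hf.continuous.pow 2).integrable_of_hasCompactSupport ?_
  exact hc.sq

lemma integrable_weighted (t : ℝ) : Integrable fun x => (jb (nrm2 x - t)) ^ 2 *
    ∑ a : Fin 2, ((spd a f x) ^ 2 + (spd a (spd 0 f) x) ^ 2 +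
      (spd a (spd 1 f) x) ^ 2 + (spd a (dth f) x) ^ 2) := by
  have hw : Continuous fun x : Sp => (jb (nrm2 x - t)) ^ 2 := by
    simp_rw [jb_sq]
    exact continuous_const.add
      (((Real.continuous_sqrt.comp (by fun_prop)).sub continuous_const).pow 2)
  have hm {g : Sp → ℝ} (hg : ContDiff ℝ (⊤ : ℕ∞) g) (hgc : HasCompactSupport g) :
      Integrable fun x => (jb (nrm2 x - t)) ^ 2 * g x ^ 2 := by
    refine (hw.mul (hg.continuous.pow 2)).integrable_of_hasCompactSupport ?_
    exact hgc.sq.mul_left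
  simp_rw [Finset.mul_sum, mul_add]
  refine integrable_finsetSum _ fun a _ => ?_
  exact (((hm (hf.spd a) (hc.spd a)).add (hm ((hf.spd 0).spd a) ((hc.spd 0).spd a))).add
    (hm ((hf.spd 1).spd a) ((hc.spd 1).spd a))).add (hm (hf.dth.spd a) (hc.dth.spd a))

lemma integrable_energyDensity (t : ℝ) : Integrable (energyDensity t f) :=
  (integrable_sq hf hc).add (integrable_weighted hf hc t)

/-- A Hardy inequality on the light cone: the angular derivative is controlled in `L²`. -/
lemma integral_dth_sq_le {t : ℝ} (ht : 0 < t) :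
    ∫ x, dth f x ^ 2 ≤ 160 * ∫ x, energyDensity t f x := by
  set g := dth f with hg
  have hgs : ContDiff ℝ (⊤ : ℕ∞) g := hf.dth
  have hgc : HasCompactSupport g := hc.dth
  have hq := contDiff_coneWeight ht
  let X (i : Fin 2) : Sp → ℝ := fun y => (y i * coneWeight t y) * (g y * g y)
  have hX (i : Fin 2) : ContDiff ℝ (⊤ : ℕ∞) (X i) := by
    simp only [X]; fun_prop
  have hXc (i : Fin 2) : HasCompactSupport (X i) := (hgc.mul_left).mul_left
  have hXi (i : Fin 2) : Integrable (spd i (X i)) :=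
    ((hX i).spd i).continuous.integrable_of_hasCompactSupport ((hXc i).spd i)
  have key (x : Sp) : 1 / 4 * g x ^ 2 ≤
      (spd 0 (X 0) x + spd 1 (X 1) x) + 40 * energyDensity t f x := by
    have hdg := hgs.differentiable_top
    have hdq := hq.differentiable_top
    have hdX (i : Fin 2) : spd i (X i) x =
        (coneWeight t x + x i * spd i (coneWeight t) x) * g x ^ 2
          + 2 * (x i * coneWeight t x) * (g x * spd i g x) := by
      rw [spd_mul (by fun_prop) (by fun_prop), spd_mul (by fun_prop) (by fun_prop),
        spd_mul hdg hdg, spd_coord]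
      simp
      ring
    rw [hdX, hdX, spd_coneWeight ht, spd_coneWeight ht]
    have hP := normSq_add_sq_pos ht x
    have hr := nrm2_sq x
    have hr0 := nrm2_nonneg x
    have hgx : g x = x 0 * spd 1 f x - x 1 * spd 0 f x := rfl
    have hE : (nrm2 x - t) ^ 2 * (spd 0 f x ^ 2 + spd 1 f x ^ 2 + spd 0 g x ^ 2 + spd 1 g x ^ 2)
        ≤ energyDensity t f x := by
      unfold energyDensity
      rw [jb_sq, Fin.sum_univ_two, ← hg]
      generalize spd 0 f x = a1, spd 1 f x = a2, spd 0 g x = a3, spd 1 g x = a4,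
        spd 0 (spd 0 f) x = b1, spd 1 (spd 0 f) x = b2, spd 0 (spd 1 f) x = b3,
        spd 1 (spd 1 f) x = b4, nrm2 x = r, f x = F
      have : 0 ≤ F ^ 2 + (a1 ^ 2 + a2 ^ 2 + a3 ^ 2 + a4 ^ 2) +
        (1 + (r - t) ^ 2) * (b1 ^ 2 + b2 ^ 2 + b3 ^ 2 + b4 ^ 2) := by positivity
      nlinarith [this]
    have hc1 : coneWeight t x = (nrm2 x ^ 2 - t ^ 2) / (nrm2 x ^ 2 + t ^ 2) := by
      rw [coneWeight, hr]
    have hp1 : invWeight t x = (nrm2 x ^ 2 + t ^ 2)⁻¹ := by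
      rw [invWeight, hr]
    have hcs : (x 0 * spd 0 g x + x 1 * spd 1 g x) ^ 2 ≤
        nrm2 x ^ 2 * (spd 0 g x ^ 2 + spd 1 g x ^ 2) := by
      rw [hr]; nlinarith [sq_nonneg (x 0 * spd 1 g x - x 1 * spd 0 g x)]
    have hgr : g x ^ 2 ≤ nrm2 x ^ 2 * (spd 0 f x ^ 2 + spd 1 f x ^ 2) := by
      rw [hr, hgx]; nlinarith [sq_nonneg (x 0 * spd 0 f x + x 1 * spd 1 f x)]
    have hdiv : ∀ q p : ℝ, (q + x 0 * (4 * t ^ 2 * (x 0 * (p * p)))) * g x ^ 2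
          + 2 * (x 0 * q) * (g x * spd 0 g x)
        + ((q + x 1 * (4 * t ^ 2 * (x 1 * (p * p)))) * g x ^ 2
          + 2 * (x 1 * q) * (g x * spd 1 g x))
        = (2 * q + 4 * t ^ 2 * nrm2 x ^ 2 * p ^ 2) * g x ^ 2 +
          2 * q * g x * (x 0 * spd 0 g x + x 1 * spd 1 g x) := by
      intro q p; rw [hr]; ring
    rw [hdiv, hc1, hp1]
    have hA0 : 0 ≤ spd 0 f x ^ 2 + spd 1 f x ^ 2 := by positivity
    have hB0 : 0 ≤ spd 0 g x ^ 2 + spd 1 g x ^ 2 := by positivity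
    have hE' : (nrm2 x - t) ^ 2 * ((spd 0 f x ^ 2 + spd 1 f x ^ 2) +
        (spd 0 g x ^ 2 + spd 1 g x ^ 2)) ≤ energyDensity t f x :=
      le_trans (le_of_eq (by ring)) hE
    refine (cone_hardy_bound hr0 ht hA0 hB0 hgr hcs).trans ?_
    linarith
  have hEi := integrable_energyDensity hf hc t
  have hmono := integral_mono ((integrable_sq hgs hgc).const_mul (1 / 4))
    (((hXi 0).add (hXi 1)).add (hEi.const_mul 40)) key
  have hsum : ∫ x, ((spd 0 (X 0) + spd 1 (X 1)) + fun x => 40 * energyDensity t f x) x =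
      40 * ∫ x, energyDensity t f x := by
    rw [integral_add' ((hXi 0).add (hXi 1)) (hEi.const_mul 40), integral_add' (hXi 0) (hXi 1),
      integral_spd_eq_zero (hX 0) (hXc 0), integral_spd_eq_zero (hX 1) (hXc 1),
      integral_const_mul]
    ring
  rw [hsum, integral_const_mul] at hmono
  linarith

end smooth

lemma cone_decay_bound {t W q q0 q1 q01 F f0 f1 f01 E : ℝ} (ht : 1 ≤ t) (hW : 1 ≤ W)
    (hq : |q| ≤ 1) (htq : (t * q) ^ 2 ≤ 4 * W) (htq0 : (t * q0) ^ 2 ≤ 4)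
    (htq1 : (t * q1) ^ 2 ≤ 4) (htq01 : (t * q01) ^ 2 ≤ 64)
    (hE : F ^ 2 + W * (f0 ^ 2 + f1 ^ 2 + f01 ^ 2) ≤ E) :
    2 * |(q0 * F + q * f0) * (q1 * F + q * f1) +
      q * F * (q01 * F + q1 * f0 + (q0 * f1 + q * f01))| * t ≤ 273 * E := by
  have hW0 : 0 ≤ W := by linarith
  have hprod {a b A B : ℝ} (h : a ^ 2 ≤ A) (hb : b ^ 2 ≤ B) (hA : 0 ≤ A) :
      (a * b) ^ 2 ≤ A * B := by
    rw [mul_pow]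
    exact mul_le_mul h hb (sq_nonneg _) hA
  have hle {y : ℝ} : y ^ 2 ≤ W * y ^ 2 := le_mul_of_one_le_left (sq_nonneg _) hW
  have a0 := hprod htq0 (le_refl (F ^ 2)) (by norm_num)
  have a1 := hprod htq1 (le_refl (F ^ 2)) (by norm_num)
  have a2 := hprod htq01 (le_refl (F ^ 2)) (by norm_num)
  have b0 := hprod htq (le_refl (f0 ^ 2)) (by positivity)
  have b1 := hprod htq (le_refl (f1 ^ 2)) (by positivity)
  have b2 := hprod htq (le_refl (f01 ^ 2)) (by positivity)
  have c0 := hprod htq1 (hle (y := f0)) (by norm_num)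
  have c1 := hprod htq0 (hle (y := f1)) (by norm_num)
  have hqF : (q * F) ^ 2 ≤ F ^ 2 := by
    rw [mul_pow]
    exact mul_le_of_le_one_left (sq_nonneg _) ((sq_le_one_iff_abs_le_one q).2 hq)
  have hadd (a b : ℝ) : (a + b) ^ 2 ≤ 2 * (a ^ 2 + b ^ 2) := by nlinarith [sq_nonneg (a - b)]
  set X := q0 * F + q * f0
  set Y := q1 * F + q * f1
  set Z := q01 * F + q1 * f0 + (q0 * f1 + q * f01)
  have hX : (t * X) ^ 2 ≤ 8 * F ^ 2 + 8 * (W * f0 ^ 2) := by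
    have := hadd (t * q0 * F) (t * q * f0)
    rw [show t * X = t * q0 * F + t * q * f0 by ring]
    linarith
  have hY : (t * Y) ^ 2 ≤ 8 * F ^ 2 + 8 * (W * f1 ^ 2) := by
    have := hadd (t * q1 * F) (t * q * f1)
    rw [show t * Y = t * q1 * F + t * q * f1 by ring]
    linarith
  have hZ : (t * Z) ^ 2 ≤ 256 * F ^ 2 + 16 * (W * f0 ^ 2) + 16 * (W * f1 ^ 2)
      + 16 * (W * f01 ^ 2) := by
    have h1 := hadd (t * q01 * F + t * q1 * f0) (t * q0 * f1 + t * q * f01)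
    have h2 := hadd (t * q01 * F) (t * q1 * f0)
    have h3 := hadd (t * q0 * f1) (t * q * f01)
    rw [show t * Z = t * q01 * F + t * q1 * f0 + (t * q0 * f1 + t * q * f01) by ring]
    linarith
  have hXY : 2 * |X * Y| * t ≤ (t * X) ^ 2 + (t * Y) ^ 2 := by
    rw [abs_mul]
    have h1 : 2 * (|X| * |Y|) ≤ X ^ 2 + Y ^ 2 := by
      nlinarith [sq_nonneg (|X| - |Y|), sq_abs X, sq_abs Y]
    have h2 : t ≤ t ^ 2 := by nlinarith
    calc _ ≤ (X ^ 2 + Y ^ 2) * t ^ 2 := by gcongr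
      _ = _ := by ring
  have hFZ : 2 * |q * F * Z| * t ≤ (q * F) ^ 2 + (t * Z) ^ 2 := by
    rw [abs_mul, mul_pow t, ← sq_abs (q * F), ← sq_abs Z]
    nlinarith [sq_nonneg (|q * F| - t * |Z|)]
  have habs := abs_add_le (X * Y) (q * F * Z)
  have := mul_le_mul_of_nonneg_right habs (by linarith : 0 ≤ t)
  have p0 : 0 ≤ W * f0 ^ 2 := by positivity
  have p1 : 0 ≤ W * f1 ^ 2 := by positivity
  have p2 : 0 ≤ W * f01 ^ 2 := by positivity
  linarith

lemma le_integral_of_enorm_le {a : ℝ} {F : Sp → ENNReal} {H : Sp → ℝ} (hH : Integrable H)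
    (hH0 : ∀ x, 0 ≤ H x) (hF : ∀ x, F x ≤ ENNReal.ofReal (H x)) (h : ‖a‖ₑ ≤ ∫⁻ x, F x) :
    |a| ≤ ∫ x, H x := by
  have h1 : ‖a‖ₑ ≤ ENNReal.ofReal (∫ x, H x) := by
    rw [ofReal_integral_eq_lintegral_ofReal hH (.of_forall hH0)]
    exact h.trans (lintegral_mono hF)
  rw [← ofReal_norm, ENNReal.ofReal_le_ofReal_iff (integral_nonneg hH0)] at h1
  exact h1

lemma abs_coneWeight_le_one {t : ℝ} (ht : 0 < t) (x : Sp) : |coneWeight t x| ≤ 1 := by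
  have hP := normSq_add_sq_pos ht x
  rw [coneWeight, abs_div, abs_of_pos hP, div_le_one hP, abs_le]
  constructor <;> nlinarith [mul_self_nonneg (x 0), mul_self_nonneg (x 1), sq_nonneg t]

lemma mul_coneWeight_sq_le {t : ℝ} (ht : 0 < t) (x : Sp) :
    (t * coneWeight t x) ^ 2 ≤ 4 * jb (nrm2 x - t) ^ 2 := by
  have hP := normSq_add_sq_pos ht x
  rw [coneWeight, ← nrm2_sq, jb_sq] at *
  have hr := nrm2_nonneg x
  generalize nrm2 x = r at *
  rw [← mul_div_assoc, div_pow, div_le_iff₀ (by positivity)]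
  have h1 : (r + t) * t ≤ 2 * (r ^ 2 + t ^ 2) := by nlinarith [sq_nonneg (r - t)]
  have h2 : ((r + t) * t) ^ 2 ≤ (2 * (r ^ 2 + t ^ 2)) ^ 2 := pow_le_pow_left₀ (by positivity) h1 2
  nlinarith [mul_le_mul_of_nonneg_left h2 (sq_nonneg (r - t)), sq_nonneg (r ^ 2 + t ^ 2)]

lemma mul_spd_coneWeight_sq_le {t : ℝ} (ht : 0 < t) (i : Fin 2) (x : Sp) :
    (t * spd i (coneWeight t) x) ^ 2 ≤ 4 := by
  have hP := normSq_add_sq_pos ht x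
  simp only [spd_coneWeight ht, invWeight]
  have hi : x i ^ 2 ≤ x 0 * x 0 + x 1 * x 1 := by
    fin_cases i <;> simp [pow_two, mul_self_nonneg]
  have h0 : t * (4 * t ^ 2 * (x i * ((x 0 * x 0 + x 1 * x 1 + t ^ 2)⁻¹ *
      (x 0 * x 0 + x 1 * x 1 + t ^ 2)⁻¹))) =
      4 * t ^ 3 * x i / (x 0 * x 0 + x 1 * x 1 + t ^ 2) ^ 2 := by
    field_simp
  rw [h0]
  generalize x 0 * x 0 + x 1 * x 1 = N at *
  generalize x i = y at *
  have hy : 0 ≤ N := (sq_nonneg y).trans hi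
  rw [div_pow, div_le_iff₀ (by positivity)]
  have h1 : 4 * (t ^ 2 * y ^ 2) ≤ (N + t ^ 2) ^ 2 := by
    nlinarith [sq_nonneg (N - t ^ 2), mul_le_mul_of_nonneg_left hi (sq_nonneg t)]
  have h2 : (t ^ 2) ^ 2 ≤ (N + t ^ 2) ^ 2 := pow_le_pow_left₀ (by positivity) (by linarith) 2
  calc (4 * t ^ 3 * y) ^ 2 = 4 * ((4 * (t ^ 2 * y ^ 2)) * (t ^ 2) ^ 2) := by ring
    _ ≤ 4 * ((N + t ^ 2) ^ 2 * (N + t ^ 2) ^ 2) := by gcongr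
    _ = _ := by ring

lemma mul_spd_spd_coneWeight_sq_le {t : ℝ} (ht : 1 ≤ t) (x : Sp) :
    (t * spd 0 (spd 1 (coneWeight t)) x) ^ 2 ≤ 64 := by
  have ht0 : 0 < t := by linarith
  have hP := normSq_add_sq_pos ht0 x
  rw [spd_spd_coneWeight ht0, invWeight]
  have h0 : t * (-16 * t ^ 2 * x 0 * x 1 * (x 0 * x 0 + x 1 * x 1 + t ^ 2)⁻¹ ^ 3) =
      -16 * t ^ 3 * (x 0 * x 1) / (x 0 * x 0 + x 1 * x 1 + t ^ 2) ^ 3 := by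
    field_simp
  rw [h0]
  have hi : 2 * |x 0 * x 1| ≤ x 0 * x 0 + x 1 * x 1 := by
    rw [abs_mul]
    nlinarith [sq_nonneg (|x 0| - |x 1|), abs_mul_abs_self (x 0), abs_mul_abs_self (x 1)]
  generalize x 0 * x 0 + x 1 * x 1 = N at *
  generalize x 0 * x 1 = y at *
  have hy : 0 ≤ N := by linarith [abs_nonneg y]
  have habs : |-16 * t ^ 3 * y / (N + t ^ 2) ^ 3| ≤ 8 := by
    rw [abs_div, abs_mul, abs_mul, abs_of_pos (by positivity : 0 < (N + t ^ 2) ^ 3),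
      abs_of_pos (by positivity : 0 < t ^ 3), div_le_iff₀ (by positivity)]
    have h3 : t ^ 3 ≤ (N + t ^ 2) ^ 2 := by
      have : t ^ 3 ≤ (t ^ 2) ^ 2 := by nlinarith [pow_pos ht0 3]
      exact this.trans (pow_le_pow_left₀ (by positivity) (by linarith) 2)
    have h4 : 2 * |y| ≤ N + t ^ 2 := by nlinarith [sq_nonneg t]
    calc |(-16 : ℝ)| * t ^ 3 * |y| = 8 * (t ^ 3 * (2 * |y|)) := by norm_num; ring
      _ ≤ 8 * ((N + t ^ 2) ^ 2 * (N + t ^ 2)) := by gcongr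
      _ = _ := by ring
  have := sq_le_sq' (abs_le.1 habs).1 (abs_le.1 habs).2
  linarith

lemma sq_add_le_energyDensity (t : ℝ) (f : Sp → ℝ) (x : Sp) :
    f x ^ 2 + jb (nrm2 x - t) ^ 2 * (spd 0 f x ^ 2 + spd 1 f x ^ 2 + spd 0 (spd 1 f) x ^ 2
      + spd 0 (dth f) x ^ 2 + spd 1 (dth f) x ^ 2) ≤ energyDensity t f x := by
  unfold energyDensity
  rw [Fin.sum_univ_two]
  refine add_le_add le_rfl (mul_le_mul_of_nonneg_left ?_ (sq_nonneg _))
  nlinarith [sq_nonneg (spd 0 (spd 0 f) x), sq_nonneg (spd 1 (spd 0 f) x),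
    sq_nonneg (spd 1 (spd 1 f) x)]

lemma sq_add_le_energyDensity' (t : ℝ) (f : Sp → ℝ) (x : Sp) :
    f x ^ 2 + (spd 0 f x ^ 2 + spd 1 f x ^ 2 + spd 0 (spd 1 f) x ^ 2
      + spd 0 (dth f) x ^ 2 + spd 1 (dth f) x ^ 2) ≤ energyDensity t f x := by
  refine le_trans ?_ (sq_add_le_energyDensity t f x)
  gcongr
  refine le_mul_of_one_le_left (by positivity) ?_
  rw [jb_sq]
  nlinarith [sq_nonneg (nrm2 x - t)]

section smooth

variable {f : Sp → ℝ} (hf : ContDiff ℝ (⊤ : ℕ∞) f) (hc : HasCompactSupport f)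
include hf

lemma spd_spd_mul {g : Sp → ℝ} (hg : ContDiff ℝ (⊤ : ℕ∞) g) (x : Sp) :
    spd 0 (spd 1 (fun y => f y * g y)) x = spd 0 (spd 1 f) x * g x + spd 1 f x * spd 0 g x
      + (spd 0 f x * spd 1 g x + f x * spd 0 (spd 1 g) x) := by
  have e : spd 1 (fun y => f y * g y) = fun y => spd 1 f y * g y + f y * spd 1 g y :=
    funext fun y => spd_mul hf.differentiable_top hg.differentiable_top 1 y
  have h1 := (hf.spd 1).differentiable_top
  have h2 := (hg.spd 1).differentiable_top
  have h3 := hf.differentiable_top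
  have h4 := hg.differentiable_top
  rw [e, spd_add (f := fun y => spd 1 f y * g y) (g := fun y => f y * spd 1 g y) (by fun_prop)
      (by fun_prop), spd_mul h1 h4, spd_mul h3 h2]

include hc

/-- If `2 |∂₁F ∂₂F + F ∂₁∂₂F|` is dominated by an integrable `H`, then `F² ≤ ∫ H`. -/
lemma sq_le_integral_of_spd_spd_le {H : Sp → ℝ} (hH : Integrable H)
    (h : ∀ x, 2 * |spd 0 f x * spd 1 f x + f x * spd 0 (spd 1 f) x| ≤ H x) (x₀ : Sp) :
    f x₀ ^ 2 ≤ ∫ x, H x := by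
  have hu : ContDiff ℝ (⊤ : ℕ∞) fun y => f y * f y := hf.mul hf
  have huc : HasCompactSupport fun y => f y * f y := hc.mul_left
  have hb := enorm_le_lintegral_spd_spd hu huc x₀
  have := le_integral_of_enorm_le hH (fun x => le_trans (by positivity) (h x)) (fun x => ?_) hb
  · rw [pow_two]
    exact (le_abs_self _).trans this
  · rw [← ofReal_norm]
    refine ENNReal.ofReal_le_ofReal (le_trans (le_of_eq ?_) (h x))
    rw [spd_spd_mul hf hf, Real.norm_eq_abs, ← abs_two, ← abs_mul]
    congr 1
    ring

lemma sq_le_integral_energyDensity (t : ℝ) (x₀ : Sp) :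
    f x₀ ^ 2 ≤ ∫ x, energyDensity t f x := by
  refine sq_le_integral_of_spd_spd_le hf hc (integrable_energyDensity hf hc t) (fun x => ?_) x₀
  have h := sq_add_le_energyDensity' t f x
  have h' : 2 * |spd 0 f x * spd 1 f x + f x * spd 0 (spd 1 f) x| ≤
      f x ^ 2 + spd 0 f x ^ 2 + spd 1 f x ^ 2 + spd 0 (spd 1 f) x ^ 2 := by
    rw [← abs_two, ← abs_mul, abs_le]
    constructor <;> nlinarith [sq_nonneg (spd 0 f x - spd 1 f x), sq_nonneg (spd 0 f x + spd 1 f x),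
      sq_nonneg (f x - spd 0 (spd 1 f) x), sq_nonneg (f x + spd 0 (spd 1 f) x)]
  linarith [sq_nonneg (spd 0 (dth f) x), sq_nonneg (spd 1 (dth f) x)]

/-- Decay away from the light cone. -/
lemma mul_coneWeight_mul_sq_le {t : ℝ} (ht : 1 ≤ t) (x₀ : Sp) :
    t * (coneWeight t x₀ * f x₀) ^ 2 ≤ 273 * ∫ x, energyDensity t f x := by
  have ht0 : 0 < t := by linarith
  have hq := contDiff_coneWeight ht0
  have hF := hq.mul hf
  have hFc : HasCompactSupport fun x => coneWeight t x * f x := hc.mul_left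
  have hE := integrable_energyDensity hf hc t
  have key := sq_le_integral_of_spd_spd_le hF hFc (hE.const_mul (273 / t)) (fun x => ?_) x₀
  · rw [integral_const_mul] at key
    calc _ ≤ t * (273 / t * ∫ x, energyDensity t f x) := by gcongr
      _ = _ := by field_simp
  · rw [spd_spd_mul hq hf, spd_mul hq.differentiable_top hf.differentiable_top,
      spd_mul hq.differentiable_top hf.differentiable_top, div_mul_eq_mul_div,
      le_div_iff₀ ht0]
    have hEx := sq_add_le_energyDensity t f x
    have hW1 : 1 ≤ jb (nrm2 x - t) ^ 2 := by
      rw [jb_sq]; nlinarith [sq_nonneg (nrm2 x - t)]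
    have hq1 := abs_coneWeight_le_one ht0 x
    have hq2 := mul_coneWeight_sq_le ht0 x
    have hq3 := mul_spd_coneWeight_sq_le ht0 0 x
    have hq4 := mul_spd_coneWeight_sq_le ht0 1 x
    have hq5 := mul_spd_spd_coneWeight_sq_le ht x
    have hdrop : f x ^ 2 + jb (nrm2 x - t) ^ 2 *
        (spd 0 f x ^ 2 + spd 1 f x ^ 2 + spd 0 (spd 1 f) x ^ 2) ≤ energyDensity t f x := by
      refine le_trans ?_ hEx
      refine add_le_add le_rfl (mul_le_mul_of_nonneg_left ?_ (sq_nonneg _))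
      nlinarith [sq_nonneg (spd 0 (dth f) x), sq_nonneg (spd 1 (dth f) x)]
    exact cone_decay_bound ht hW1 hq1 hq2 hq3 hq4 hq5 hdrop

/-- Decay near and outside the light cone. -/
lemma nrm2_mul_sq_le {t : ℝ} (ht : 0 < t) {x₀ : Sp} (hx : 0 < nrm2 x₀) :
    nrm2 x₀ * f x₀ ^ 2 ≤ 800 * ∫ x, energyDensity t f x := by
  obtain ⟨θ₀, hθ₀, hθ⟩ := exists_polarPt_eq x₀
  set R := nrm2 x₀
  set g := dth f with hg
  have hgs : ContDiff ℝ (⊤ : ℕ∞) g := hf.dth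
  have hgc : HasCompactSupport g := hc.dth
  have hd (θ : ℝ) : HasDerivAt (fun θ => f (polarPt R θ) * f (polarPt R θ))
      (2 * (f (polarPt R θ) * g (polarPt R θ))) θ := by
    have hp : HasDerivAt (polarPt R) ![-(R * sin θ), R * cos θ] θ := by
      rw [hasDerivAt_pi]
      intro i
      fin_cases i
      · simpa [polarPt] using (hasDerivAt_cos θ).const_mul R
      · simpa [polarPt] using (hasDerivAt_sin θ).const_mul R
    have hfp : HasDerivAt (fun θ => f (polarPt R θ)) (g (polarPt R θ)) θ := by
      have := (hf.differentiable_top (polarPt R θ)).hasFDerivAt.comp_hasDerivAt θ hp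
      rw [fderiv_apply_eq_spd] at this
      refine HasDerivAt.congr_deriv this ?_
      simp [hg, dth, polarPt]
      ring
    exact (hfp.mul hfp).congr_deriv (by ring)
  have hpc : Continuous (polarPt R) := by
    unfold polarPt; fun_prop
  have hfc := hf.continuous
  have hgcont := hgs.continuous
  have hang := enorm_le_lintegral_angle hd (by fun_prop) hθ₀
  have hu1 : ContDiff ℝ (⊤ : ℕ∞) fun y => f y * f y := hf.mul hf
  have hu2 : ContDiff ℝ (⊤ : ℕ∞) fun y => 2 * (f y * g y) := contDiff_const.mul (hf.mul hgs)
  have hc1 : HasCompactSupport fun y => f y * f y := hc.mul_left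
  have hc2 : HasCompactSupport fun y => 2 * (f y * g y) := (hgc.mul_left).mul_left
  have hr1 := lintegral_circle_le hu1 hc1 hx
  have hr2 := lintegral_circle_le hu2 hc2 hx
  rw [hθ] at hang
  have htot : ‖R * (f x₀ * f x₀)‖ₑ ≤ ∫⁻ x : Sp, ((‖spd 0 (fun y => f y * f y) x‖ₑ +
      ‖spd 1 (fun y => f y * f y) x‖ₑ) + (‖spd 0 (fun y => 2 * (f y * g y)) x‖ₑ +
      ‖spd 1 (fun y => 2 * (f y * g y)) x‖ₑ)) := by
    rw [lintegral_add_left]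
    · refine le_trans ?_ (add_le_add hr1 hr2)
      rw [← mul_add, enorm_mul, Real.enorm_eq_ofReal hx.le]
      gcongr
    · exact (hu1.spd 0).continuous.measurable.enorm.add (hu1.spd 1).continuous.measurable.enorm
  have hE := integrable_energyDensity hf hc t
  have hH : Integrable fun x => 4 * energyDensity t f x + 4 * g x ^ 2 :=
    (hE.const_mul 4).add ((integrable_sq hgs hgc).const_mul 4)
  have hfin := le_integral_of_enorm_le hH (fun x => ?_) (fun x => ?_) htot
  · have hh := integral_dth_sq_le hf hc ht
    rw [integral_add (hE.const_mul 4) ((integrable_sq hgs hgc).const_mul 4), integral_const_mul,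
      integral_const_mul] at hfin
    have := (le_abs_self _).trans hfin
    have hE0 : 0 ≤ ∫ x, energyDensity t f x := integral_nonneg (energyDensity_nonneg t f)
    rw [pow_two]
    linarith
  · have := energyDensity_nonneg t f x
    positivity
  · have hfd := hf.differentiable_top
    have hgd := hgs.differentiable_top
    have h2 (i : Fin 2) : spd i (fun y => 2 * (f y * g y)) x =
        2 * (spd i f x * g x + f x * spd i g x) := by
      rw [spd_mul (f := fun _ => 2) (by fun_prop) (by fun_prop), spd_mul hfd hgd]
      simp [spd]
    rw [h2, h2, spd_mul hfd hfd, spd_mul hfd hfd, ← ofReal_norm, ← ofReal_norm, ← ofReal_norm,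
      ← ofReal_norm, ← ENNReal.ofReal_add (norm_nonneg _) (norm_nonneg _),
      ← ENNReal.ofReal_add (norm_nonneg _) (norm_nonneg _),
      ← ENNReal.ofReal_add (by positivity) (by positivity)]
    refine ENNReal.ofReal_le_ofReal ?_
    have hEx := sq_add_le_energyDensity' t f x
    rw [← hg] at hEx
    have hsq (a : ℝ) {b c : ℝ} (_ : a = b * c) : |a| ≤ (b ^ 2 + c ^ 2) / 2 := by
      rw [abs_le]; constructor <;> nlinarith [sq_nonneg (b + c), sq_nonneg (b - c)]
    have e1 (i : Fin 2) : ‖spd i f x * f x + f x * spd i f x‖ ≤ spd i f x ^ 2 + f x ^ 2 := by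
      rw [Real.norm_eq_abs, abs_le]
      constructor <;> nlinarith [sq_nonneg (spd i f x + f x), sq_nonneg (spd i f x - f x)]
    have e2 (i : Fin 2) : ‖2 * (spd i f x * g x + f x * spd i g x)‖ ≤
        spd i f x ^ 2 + g x ^ 2 + f x ^ 2 + spd i g x ^ 2 := by
      rw [Real.norm_eq_abs, abs_le]
      constructor <;> nlinarith [sq_nonneg (spd i f x + g x), sq_nonneg (spd i f x - g x),
        sq_nonneg (f x + spd i g x), sq_nonneg (f x - spd i g x)]
    have := e1 0
    have := e1 1
    have := e2 0
    have := e2 1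
    nlinarith [sq_nonneg (g x), sq_nonneg (spd 0 (spd 1 f) x), sq_nonneg (spd 0 g x),
      sq_nonneg (spd 1 g x), sq_nonneg (spd 0 f x), sq_nonneg (spd 1 f x)]

lemma jb_mul_sq_le {t : ℝ} (ht : 0 ≤ t) (x₀ : Sp) :
    jb t * f x₀ ^ 2 ≤ 3200 * ∫ x, energyDensity t f x := by
  have hE0 : 0 ≤ ∫ x, energyDensity t f x := integral_nonneg (energyDensity_nonneg t f)
  have hjb : jb t ≤ 1 + t := by
    rw [jb, Real.sqrt_le_left (by positivity)]
    nlinarith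
  rcases le_total t 1 with h1 | h1
  · have h := sq_le_integral_energyDensity hf hc t x₀
    nlinarith [mul_le_mul_of_nonneg_right (hjb.trans (by linarith : 1 + t ≤ 2)) (sq_nonneg (f x₀))]
  have ht0 : 0 < t := by linarith
  have hjb2 := mul_le_mul_of_nonneg_right (hjb.trans (by linarith : 1 + t ≤ 2 * t))
    (sq_nonneg (f x₀))
  rcases le_or_gt (nrm2 x₀) (t / 2) with h2 | h2
  · have h := mul_coneWeight_mul_sq_le hf hc h1 x₀
    have hq : (3 / 5) ^ 2 ≤ coneWeight t x₀ ^ 2 := by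
      rw [← neg_sq (coneWeight t x₀)]
      refine pow_le_pow_left₀ (by norm_num) ?_ 2
      have hP := normSq_add_sq_pos ht0 x₀
      rw [coneWeight, ← neg_div, le_div_iff₀ hP]
      rw [← nrm2_sq] at *
      nlinarith [nrm2_nonneg x₀]
    have := mul_le_mul_of_nonneg_right hq (by positivity : 0 ≤ t * f x₀ ^ 2)
    nlinarith
  · have h := nrm2_mul_sq_le hf hc ht0 (x₀ := x₀) (by linarith)
    have := mul_le_mul_of_nonneg_right h2.le (sq_nonneg (f x₀))
    nlinarith

end smooth

/-- Decay estimate: for f ∈ C_c^∞(ℝ²) and t ≥ 0,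
‖f‖_∞ ≲ ⟨t⟩^{−1/2} ( ‖f‖₂ + ‖⟨|x|−t⟩ ∇Γ̃^{≤1}f‖₂ ) with Γ̃ = (∂₁, ∂₂, ∂_θ). -/
theorem statement16 :
    ∃ C > (0 : ℝ), ∀ f : Sp → ℝ, ContDiff ℝ (⊤ : ℕ∞) f → HasCompactSupport f →
      ∀ t : ℝ, 0 ≤ t → ∀ x₀ : Sp,
        |f x₀| ≤ C * (jb t) ^ (-(1 : ℝ) / 2) *
          (L2 f + Real.sqrt (∫ x : Sp, (jb (nrm2 x - t)) ^ 2 *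
              ∑ a : Fin 2,
                ((spd a f x) ^ 2 + (spd a (spd 0 f) x) ^ 2 +
                  (spd a (spd 1 f) x) ^ 2 + (spd a (dth f) x) ^ 2))) := by
  refine ⟨60, by norm_num, fun f hf hc t ht x₀ => ?_⟩
  have hjb : 0 < jb t := Real.sqrt_pos.2 (by positivity)
  have hQ := jb_mul_sq_le hf hc ht x₀
  have hsplit : ∫ x, energyDensity t f x = (∫ x, f x ^ 2) + ∫ x : Sp, (jb (nrm2 x - t)) ^ 2 *
      ∑ a : Fin 2, ((spd a f x) ^ 2 + (spd a (spd 0 f) x) ^ 2 +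
        (spd a (spd 1 f) x) ^ 2 + (spd a (dth f) x) ^ 2) :=
    integral_add (integrable_sq hf hc) (integrable_weighted hf hc t)
  have h1 : 0 ≤ ∫ x, f x ^ 2 := integral_nonneg fun x => sq_nonneg _
  have h2 : 0 ≤ ∫ x : Sp, (jb (nrm2 x - t)) ^ 2 *
      ∑ a : Fin 2, ((spd a f x) ^ 2 + (spd a (spd 0 f) x) ^ 2 +
        (spd a (spd 1 f) x) ^ 2 + (spd a (dth f) x) ^ 2) :=
    integral_nonneg fun x => by positivity
  rw [hsplit] at hQ
  unfold L2
  generalize (∫ x, f x ^ 2) = a at *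
  generalize (∫ x : Sp, (jb (nrm2 x - t)) ^ 2 * _) = b at *
  have hsq : ((jb t) ^ (-(1 : ℝ) / 2)) ^ 2 = (jb t)⁻¹ := by
    rw [← Real.rpow_natCast, ← Real.rpow_mul hjb.le, ← Real.rpow_neg_one]
    norm_num
  refine abs_le_of_sq_le_sq ?_ (by positivity)
  rw [mul_pow, mul_pow, hsq]
  have hab : a + b ≤ (√a + √b) ^ 2 := by
    nlinarith [Real.sq_sqrt h1, Real.sq_sqrt h2, Real.sqrt_nonneg a, Real.sqrt_nonneg b,
      mul_nonneg (Real.sqrt_nonneg a) (Real.sqrt_nonneg b)]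
  calc f x₀ ^ 2 = (jb t)⁻¹ * (jb t * f x₀ ^ 2) := by field_simp
    _ ≤ (jb t)⁻¹ * (3600 * (√a + √b) ^ 2) := by 
      exact mul_le_mul_of_nonneg_left (by linarith) (inv_nonneg.2 hjb.le)
    _ = _ := by ring
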